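/- There exists a compact set A ⊆ ℝ whose packing dimension is strictly between 0 and 1, while the Hausdorff dimension of A^k is zero for every k ≥ 1. -/

import Mathlib

open scoped ENNReal

/-- The minimal number of balls of radius `δ` needed to cover `A` (`⊤` if no finite cover). -/
noncomputable def coverNum {X : Type*} [PseudoMetricSpace X] (A : Set X) (δ : ℝ) : ℕ∞ :=
  sInf {N : ℕ∞ | ∃ t : Finset X, (t.card : ℕ∞) = N ∧ A ⊆ ⋃ x ∈ t, Metric.ball x δ}

/-- Upper box-counting (Minkowski) dimension. -/
noncomputable def upperBoxDim {X : Type*} [PseudoMetricSpace X] (A : Set X) : ℝ≥0∞ :=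
  Filter.limsup (fun δ : ℝ =>
      if coverNum A δ = ⊤ then (⊤ : ℝ≥0∞)
      else ENNReal.ofReal (Real.log ((coverNum A δ).toNat : ℝ) / Real.log δ⁻¹))
    (nhdsWithin 0 (Set.Ioi (0 : ℝ)))

/-- Packing dimension, via the modified upper box dimension. -/
noncomputable def packingDim {X : Type*} [PseudoMetricSpace X] (A : Set X) : ℝ≥0∞ :=
  ⨅ (F : ℕ → Set X) (_ : A ⊆ ⋃ i, F i), ⨆ i, upperBoxDim (F i)

namespace PackEx

theorem exists_s : ∃ s : ℕ → ℕ, StrictMono s ∧ (∀ j, j * j.factorial ≤ s j.factorial) ∧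
    ∀ j, s ((j+1).factorial - 1) ≤ 2 * ((j+1).factorial - 1) := by
  let g : ℕ → ℕ := fun N =>
    ((Finset.range (N+1)).filter (fun j => j.factorial ≤ N)).sup (fun j => j * j.factorial)
  have gm : Monotone g := by
    intro a b hab
    apply Finset.sup_mono
    intro j hj
    simp only [Finset.mem_filter, Finset.mem_range] at hj ⊢
    omega
  refine ⟨fun N => N + g N, ?_, ?_, ?_⟩
  · intro a b hab
    have := gm hab.le
    simp only
    omega
  · intro j
    have : j * j.factorial ≤ g j.factorial := by
      apply Finset.le_sup (f := fun j : ℕ => j * j.factorial)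
      simp only [Finset.mem_filter, Finset.mem_range]
      exact ⟨by have := Nat.self_le_factorial j; omega, le_rfl⟩
    simp only
    omega
  · intro j
    have : g ((j+1).factorial - 1) ≤ (j+1).factorial - 1 := by
      apply Finset.sup_le
      intro i hi
      simp only [Finset.mem_filter, Finset.mem_range] at hi
      have h1 : i.factorial < (j+1).factorial := by
        have := Nat.factorial_pos (j+1); omega
      have h2 : i < j + 1 := by
        by_contra h
        have := Nat.factorial_le (not_lt.1 h)
        omega
      have h3 : i * i.factorial ≤ j * j.factorial :=
        Nat.mul_le_mul (by omega) (Nat.factorial_le (by omega))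
      have h4 := Nat.factorial_succ j
      have h5 := Nat.factorial_pos j
      have h6 : (j+1) * j.factorial = j * j.factorial + j.factorial := by ring
      omega
    simp only
    omega

noncomputable def term (s : ℕ → ℕ) (x : ℕ → Bool) (n : ℕ) : ℝ :=
  if x n then (1/4 : ℝ)^(s n) else 0

noncomputable def f (s : ℕ → ℕ) (x : ℕ → Bool) : ℝ := ∑' n, term s x n

variable {s : ℕ → ℕ}

theorem term_nonneg (x : ℕ → Bool) (n : ℕ) : 0 ≤ term s x n := by
  unfold term; split_ifs <;> positivity

theorem term_le (x : ℕ → Bool) (n : ℕ) : term s x n ≤ (1/4 : ℝ)^(s n) := by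
  unfold term; split_ifs
  · exact le_rfl
  · positivity

theorem s_add (hs : StrictMono s) (N i : ℕ) : s N + i ≤ s (i + N) := by
  induction i with
  | zero => simp
  | succ i ih =>
    have := hs (show i + N < i + 1 + N by omega)
    omega

theorem term_add_le (hs : StrictMono s) (x : ℕ → Bool) (N i : ℕ) :
    term s x (i + N) ≤ (1/4 : ℝ)^(s N) * (1/4)^i := by
  refine (term_le x _).trans ?_
  rw [← pow_add]
  exact pow_le_pow_of_le_one (by norm_num) (by norm_num) (s_add hs N i)

theorem geo : HasSum (fun i : ℕ => (1/4 : ℝ)^i) (4/3) := by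
  have := hasSum_geometric_of_lt_one (r := (1/4 : ℝ)) (by norm_num) (by norm_num)
  convert this using 1; norm_num

theorem summ_tail (hs : StrictMono s) (x : ℕ → Bool) (N : ℕ) :
    Summable (fun i => term s x (i + N)) :=
  Summable.of_nonneg_of_le (fun _ => term_nonneg x _) (fun i => term_add_le hs x N i)
    (geo.summable.mul_left _)

theorem summ (hs : StrictMono s) (x : ℕ → Bool) : Summable (term s x) :=
  summ_tail hs x 0

theorem tail_nonneg (x : ℕ → Bool) (N : ℕ) : 0 ≤ ∑' i, term s x (i + N) :=
  tsum_nonneg fun _ => term_nonneg x _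

theorem tail_le (hs : StrictMono s) (x : ℕ → Bool) (N : ℕ) :
    ∑' i, term s x (i + N) ≤ (1/4 : ℝ)^(s N) * (4/3) := by
  rw [← (geo.mul_left ((1/4 : ℝ)^(s N))).tsum_eq]
  exact (summ_tail hs x N).tsum_le_tsum (fun i => term_add_le hs x N i) (geo.summable.mul_left _)

theorem f_split (hs : StrictMono s) (x : ℕ → Bool) (N : ℕ) :
    f s x = ∑ i ∈ Finset.range N, term s x i + ∑' i, term s x (i + N) :=
  ((summ hs x).sum_add_tsum_nat_add N).symm

theorem f_cont (hs : StrictMono s) : Continuous (f s) := by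
  refine continuous_tsum (u := fun n => (1/4 : ℝ)^n) (fun n => ?_) geo.summable (fun n x => ?_)
  · have : Continuous fun b : Bool => if b then (1/4 : ℝ)^(s n) else 0 :=
      continuous_of_discreteTopology
    exact this.comp (continuous_apply n)
  · rw [Real.norm_of_nonneg (term_nonneg x n)]
    exact (term_le x n).trans
      (pow_le_pow_of_le_one (by norm_num) (by norm_num) (hs.le_apply))

theorem sum_eq {x y : ℕ → Bool} {N : ℕ} (h : ∀ n < N, x n = y n) :
    ∑ i ∈ Finset.range N, term s x i = ∑ i ∈ Finset.range N, term s y i := by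
  apply Finset.sum_congr rfl
  intro i hi
  simp [term, h i (Finset.mem_range.1 hi)]

theorem close (hs : StrictMono s) {x y : ℕ → Bool} {N : ℕ} (h : ∀ n < N, x n = y n) :
    |f s x - f s y| ≤ (1/4 : ℝ)^(s N) * (4/3) := by
  rw [f_split hs x N, f_split hs y N, sum_eq h, abs_le]
  have := tail_nonneg (s := s) x N
  have := tail_nonneg (s := s) y N
  have := tail_le hs x N
  have := tail_le hs y N
  constructor <;> linarith

theorem sep0 (hs : StrictMono s) {x y : ℕ → Bool} {N : ℕ} (h : ∀ n < N, x n = y n)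
    (hx : x N = true) (hy : y N = false) : (1/4 : ℝ)^(s N) * (2/3) ≤ f s x - f s y := by
  rw [f_split hs x (N+1), f_split hs y (N+1), Finset.sum_range_succ, Finset.sum_range_succ,
    sum_eq h]
  have h1 := tail_nonneg (s := s) x (N+1)
  have h2 := tail_le hs y (N+1)
  have h3 : (1/4 : ℝ)^(s (N+1)) ≤ (1/4 : ℝ)^(s N + 1) :=
    pow_le_pow_of_le_one (by norm_num) (by norm_num) (hs (Nat.lt_succ_self N))
  rw [pow_succ] at h3
  have h4 : term s x N = (1/4 : ℝ)^(s N) := by simp [term, hx]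
  have h5 : term s y N = 0 := by simp [term, hy]
  rw [h4, h5]
  linarith

theorem sep (hs : StrictMono s) {x y : ℕ → Bool} {N : ℕ} (h : ∃ n ≤ N, x n ≠ y n) :
    (1/4 : ℝ)^(s N) * (2/3) ≤ |f s x - f s y| := by
  classical
  have hex : ∃ n, x n ≠ y n := ⟨_, h.choose_spec.2⟩
  set n := Nat.find hex with hn
  have hne : x n ≠ y n := Nat.find_spec hex
  have hlt : ∀ m < n, x m = y m := fun m hm => not_not.1 (Nat.find_min hex hm)
  have hnN : n ≤ N := by
    obtain ⟨m, hm, hm'⟩ := h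
    exact (Nat.find_min' hex hm').trans hm
  have hp : (1/4 : ℝ)^(s N) ≤ (1/4 : ℝ)^(s n) :=
    pow_le_pow_of_le_one (by norm_num) (by norm_num) (hs.monotone hnN)
  cases hx : x n <;> cases hy : y n
  · simp [hx, hy] at hne
  · have := sep0 hs (fun m hm => (hlt m hm).symm) hy hx
    rw [abs_sub_comm]
    have := le_abs_self (f s y - f s x)
    linarith
  · have := sep0 hs hlt hx hy
    have := le_abs_self (f s x - f s y)
    linarith
  · simp [hx, hy] at hne

theorem coverNum_le (hs : StrictMono s) {δ : ℝ} (m : ℕ) (hδ : (1/4 : ℝ)^m * (4/3) < δ) :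
    coverNum (Set.range (f s)) δ ≤ ((2^m : ℕ) : ℕ∞) := by
  classical
  let e : (Fin m → Bool) → ℝ := fun τ => f s (fun n => if h : n < m then τ ⟨n, h⟩ else false)
  have h1 : coverNum (Set.range (f s)) δ ≤ ((Finset.univ.image e).card : ℕ∞) := by
    apply sInf_le
    refine ⟨_, rfl, ?_⟩
    rintro _ ⟨x, rfl⟩
    simp only [Set.mem_iUnion, Metric.mem_ball]
    refine ⟨e (fun i => x i), Finset.mem_image_of_mem _ (Finset.mem_univ _), ?_⟩
    rw [Real.dist_eq]
    refine (close hs (N := m) ?_).trans_lt (lt_of_le_of_lt ?_ hδ)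
    · intro n hn; simp [hn]
    · gcongr ?_ * _
      exact pow_le_pow_of_le_one (by norm_num) (by norm_num) hs.le_apply
  refine h1.trans ?_
  have : (Finset.univ.image e).card ≤ 2^m := by
    refine Finset.card_image_le.trans ?_
    simp
  exact_mod_cast this

theorem pack_lt (hs : StrictMono s) : packingDim (Set.range (f s)) < 1 := by
  have h1 : packingDim (Set.range (f s)) ≤ upperBoxDim (Set.range (f s)) := by
    refine (iInf₂_le (fun _ => Set.range (f s)) (Set.subset_iUnion (fun _ : ℕ => _) 0)).trans ?_
    simp
  have h2 : upperBoxDim (Set.range (f s)) ≤ ENNReal.ofReal (7/8) := by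
    refine Filter.limsup_le_of_le (by isBoundedDefault) ?_
    have : Set.Ioo (0:ℝ) (1/256) ∈ nhdsWithin 0 (Set.Ioi (0 : ℝ)) :=
      Ioo_mem_nhdsGT (by norm_num)
    filter_upwards [this] with δ hδ
    obtain ⟨h0, h1⟩ := hδ
    have hlog4 : Real.log 4 = 2 * Real.log 2 := by
      rw [show (4:ℝ) = 2^2 by norm_num, Real.log_pow]; norm_num
    have hl2 : 0 < Real.log 2 := Real.log_pos (by norm_num)
    have hL : 8 * Real.log 2 ≤ Real.log δ⁻¹ := by
      have : Real.log (2^8) = 8 * Real.log 2 := by rw [Real.log_pow]; norm_num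
      rw [← this]
      apply Real.log_le_log (by norm_num)
      rw [le_inv_comm₀ (by norm_num) h0]
      norm_num; linarith
    set L := Real.log δ⁻¹
    set m := ⌊L / Real.log 4⌋₊ + 2
    have hm1 : L / Real.log 4 + 1 < m := by
      have := Nat.lt_floor_add_one (L / Real.log 4)
      push_cast [m]; linarith
    have hm2 : (m:ℝ) ≤ L / Real.log 4 + 2 := by
      have := Nat.floor_le (show 0 ≤ L / Real.log 4 by
        apply div_nonneg <;> linarith)
      push_cast [m]; linarith
    have hc : coverNum (Set.range (f s)) δ ≤ ((2^m : ℕ) : ℕ∞) := by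
      apply coverNum_le hs
      have h3 : L + Real.log 4 < m * Real.log 4 := by
        have : 0 < Real.log 4 := by linarith
        have h := mul_lt_mul_of_pos_right hm1 this
        rwa [add_mul, div_mul_cancel₀ _ this.ne', one_mul] at h
      rw [← Real.log_pow, ← Real.log_mul (by positivity) (by norm_num)] at h3
      have h4 := (Real.log_lt_log_iff (by positivity) (by positivity)).1 h3
      rw [one_div, inv_pow, inv_mul_lt_iff₀ (by positivity)]
      have h5 := mul_lt_mul_of_pos_right h4 h0
      rw [mul_right_comm, inv_mul_cancel₀ h0.ne'] at h5
      linarith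
    have hne : coverNum (Set.range (f s)) δ ≠ ⊤ := ne_top_of_le_ne_top (ENat.natCast_ne_top _) hc
    rw [if_neg hne]
    apply ENNReal.ofReal_le_ofReal
    have hn : (coverNum (Set.range (f s)) δ).toNat ≤ 2^m := ENat.toNat_le_of_le_natCast hc
    rw [div_le_iff₀ (by linarith)]
    have h6 : Real.log ((coverNum (Set.range (f s)) δ).toNat : ℝ) ≤ m * Real.log 2 := by
      rw [← Real.log_pow]
      rcases Nat.eq_zero_or_pos (coverNum (Set.range (f s)) δ).toNat with h | h
      · rw [h]; simp; positivity
      · apply Real.log_le_log (by exact_mod_cast h)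
        exact_mod_cast hn
    have h7 : (m:ℝ) * Real.log 2 ≤ L / 2 + 2 * Real.log 2 := by
      have := mul_le_mul_of_nonneg_right hm2 hl2.le
      have h8 : L / Real.log 4 * Real.log 2 = L / 2 := by
        rw [hlog4]; field_simp
      rw [add_mul, h8] at this
      exact this
    linarith
  refine (h1.trans h2).trans_lt ?_
  rw [ENNReal.ofReal_lt_one]; norm_num

theorem le_coverNum (hs : StrictMono s) {F : Set ℝ} {x0 : ℕ → Bool} {M K : ℕ}
    (hF : ∀ x, (∀ n < M, x n = x0 n) → f s x ∈ closure F) {δ : ℝ}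
    (hδ : 2 * δ < (1/4 : ℝ)^(s (M+K)) * (2/3)) :
    ((2^(K+1) : ℕ) : ℕ∞) ≤ coverNum F δ := by
  classical
  apply le_sInf
  rintro _ ⟨t, rfl, ht⟩
  let e : (Fin (K+1) → Bool) → ℕ → Bool := fun τ n =>
    if h : M ≤ n ∧ n - M < K+1 then τ ⟨n - M, h.2⟩ else x0 n
  have hcl : closure F ⊆ ⋃ c ∈ t, Metric.closedBall c δ := by
    apply closure_minimal
    · refine ht.trans (Set.iUnion₂_mono fun c _ => Metric.ball_subset_closedBall)
    · exact t.finite_toSet.isClosed_biUnion fun c _ => Metric.isClosed_closedBall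
  have hch : ∀ τ, ∃ c ∈ t, dist (f s (e τ)) c ≤ δ := by
    intro τ
    have := hcl (hF (e τ) (by
      intro n hn
      simp [e, not_le.2 hn]))
    simpa using this
  choose c hct hcd using hch
  have hinj : Function.Injective c := by
    intro τ τ' h
    by_contra hne
    obtain ⟨i, hi⟩ := Function.ne_iff.1 hne
    have h1 := sep hs (x := e τ) (y := e τ') (N := M + K) ⟨M + i, by omega, by
      have hi2 : M + (i : ℕ) ≤ K + M := by omega
      simpa [e, hi2] using hi⟩
    have h2 := dist_triangle_right (f s (e τ)) (f s (e τ')) (c τ)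
    have h3 := hcd τ
    have h4 := hcd τ'
    rw [← h] at h4
    rw [Real.dist_eq] at h2
    linarith
  have := Finset.card_le_card_of_injOn (s := Finset.univ) (t := t) c (fun τ _ => hct τ) hinj.injOn
  simp at this
  exact_mod_cast this

theorem box_ge (hs : StrictMono s)
    (h2 : ∀ j, s ((j+1).factorial - 1) ≤ 2 * ((j+1).factorial - 1))
    {F : Set ℝ} {x0 : ℕ → Bool} {M : ℕ}
    (hF : ∀ x, (∀ n < M, x n = x0 n) → f s x ∈ closure F) :
    ENNReal.ofReal (1/8) ≤ upperBoxDim F := by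
  have hN : Filter.Tendsto (fun j : ℕ => (j+1).factorial - 1) Filter.atTop Filter.atTop := by
    apply Filter.tendsto_atTop_mono (f := fun j => j) _ Filter.tendsto_id
    intro j
    have := Nat.self_le_factorial (j+1)
    omega
  refine Filter.le_limsup_of_frequently_le ?_ (by isBoundedDefault)
  have ht : Filter.Tendsto (fun j : ℕ => (1/4 : ℝ)^(s ((j+1).factorial - 1) + 1)) Filter.atTop
      (nhdsWithin 0 (Set.Ioi (0 : ℝ))) := by
    apply tendsto_nhdsWithin_of_tendsto_nhds_of_eventually_within
    · apply (tendsto_pow_atTop_nhds_zero_of_lt_one (r := (1/4 : ℝ)) (by norm_num)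
        (by norm_num)).comp
      exact (Filter.tendsto_add_atTop_nat 1).comp (hs.tendsto_atTop.comp hN)
    · exact Filter.Eventually.of_forall fun j => by simp
  refine ht.frequently (Filter.Eventually.frequently ?_)
  filter_upwards [hN.eventually_ge_atTop (2*M)] with j hj
  have hsN := h2 j
  generalize (j+1).factorial - 1 = N at hj hsN
  obtain ⟨K, rfl⟩ : ∃ K, N = M + K := ⟨N - M, by omega⟩
  have hc := le_coverNum hs (K := K) hF (δ := (1/4 : ℝ)^(s (M+K) + 1)) (by
    have : 0 < (1/4 : ℝ)^(s (M+K)) := by positivity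
    rw [pow_succ]; linarith)
  split_ifs with h
  · exact le_top
  apply ENNReal.ofReal_le_ofReal
  have hn : 2^(K+1) ≤ (coverNum F ((1/4 : ℝ)^(s (M+K) + 1))).toNat := by
    rw [← ENat.natCast_toNat h] at hc
    exact_mod_cast hc
  have hlog4 : Real.log 4 = 2 * Real.log 2 := by
    rw [show (4:ℝ) = 2^2 by norm_num, Real.log_pow]; norm_num
  have hl2 : 0 < Real.log 2 := Real.log_pos (by norm_num)
  have hlogd : Real.log ((1/4 : ℝ)^(s (M+K) + 1))⁻¹ = (s (M+K) + 1) * (2 * Real.log 2) := by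
    rw [one_div, inv_pow, inv_inv, Real.log_pow, hlog4]; push_cast; ring
  rw [hlogd, le_div_iff₀ (by positivity)]
  have h6 : (K+1) * Real.log 2 ≤
      Real.log ((coverNum F ((1/4 : ℝ)^(s (M+K) + 1))).toNat : ℝ) := by
    have : ((K:ℝ)+1) * Real.log 2 = Real.log (2^(K+1)) := by rw [Real.log_pow]; push_cast; ring
    rw [this]
    apply Real.log_le_log (by positivity)
    exact_mod_cast hn
  refine le_trans ?_ h6
  have h7 : (s (M+K) : ℝ) + 1 ≤ 4 * (K + 1) := by
    have : s (M+K) + 1 ≤ 4 * (K+1) := by omega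
    exact_mod_cast this
  have := mul_le_mul_of_nonneg_right h7 hl2.le
  linarith

theorem pack_pos (hs : StrictMono s)
    (h2 : ∀ j, s ((j+1).factorial - 1) ≤ 2 * ((j+1).factorial - 1)) :
    0 < packingDim (Set.range (f s)) := by
  refine lt_of_lt_of_le (b := ENNReal.ofReal (1/8)) (by simp) ?_
  refine le_iInf₂ fun F hF => ?_
  have hcov : ⋃ i, f s ⁻¹' closure (F i) = Set.univ := by
    apply Set.eq_univ_of_forall
    intro x
    obtain ⟨i, hi⟩ := Set.mem_iUnion.1 (hF ⟨x, rfl⟩)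
    exact Set.mem_iUnion.2 ⟨i, subset_closure hi⟩
  obtain ⟨i, x, hx⟩ := nonempty_interior_of_iUnion_of_closed
    (fun i => isClosed_closure.preimage (f_cont hs)) hcov
  obtain ⟨_, ⟨y, M, rfl⟩, hxy, hsub⟩ :=
    (PiNat.isTopologicalBasis_cylinders (fun _ : ℕ => Bool)).exists_subset_of_mem_open hx
      isOpen_interior
  refine le_trans ?_ (le_iSup _ i)
  exact box_ge hs h2 (x0 := y) (M := M) fun z hz =>
    (interior_subset (hsub (PiNat.mem_cylinder_iff.2 hz)) : z ∈ f s ⁻¹' closure (F i))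

open MeasureTheory in
theorem dim_zero (hs : StrictMono s) (h1 : ∀ j, j * j.factorial ≤ s j.factorial) (k : ℕ) :
    dimH {u : Fin k → ℝ | ∀ j, u j ∈ Set.range (f s)} = 0 := by
  rw [← nonpos_iff_eq_zero]
  refine ENNReal.le_of_forall_pos_le_add fun d hd _ => ?_
  rw [zero_add]
  apply dimH_le_of_hausdorffMeasure_ne_top
  let r : ℕ → ℝ≥0∞ := fun j => ENNReal.ofReal ((1/4 : ℝ)^(s j.factorial) * (4/3))
  let t : ∀ j : ℕ, (Fin k → Fin j.factorial → Bool) → Set (Fin k → ℝ) := fun j σ =>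
    Set.pi Set.univ (fun i => f s '' {x | ∀ n : Fin j.factorial, x n = σ i n})
  have hfac : Filter.Tendsto (fun j : ℕ => j.factorial) Filter.atTop Filter.atTop :=
    Filter.tendsto_atTop_mono (f := fun j => j) Nat.self_le_factorial Filter.tendsto_id
  have hr : Filter.Tendsto r Filter.atTop (nhds 0) := by
    rw [← ENNReal.ofReal_zero]
    apply ENNReal.tendsto_ofReal
    rw [← zero_mul (4/3 : ℝ)]
    apply Filter.Tendsto.mul_const
    exact (tendsto_pow_atTop_nhds_zero_of_lt_one (r := (1/4 : ℝ)) (by norm_num)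
        (by norm_num)).comp (hs.tendsto_atTop.comp hfac)
  have htd : ∀ j σ, Metric.ediam (t j σ) ≤ r j := by
    intro j σ
    refine Metric.ediam_pi_le_of_le fun i => Metric.ediam_le ?_
    rintro _ ⟨x, hx, rfl⟩ _ ⟨y, hy, rfl⟩
    rw [edist_dist, Real.dist_eq]
    apply ENNReal.ofReal_le_ofReal
    apply close hs
    intro n hn
    exact (hx ⟨n, hn⟩).trans (hy ⟨n, hn⟩).symm
  have hst : ∀ j, {u : Fin k → ℝ | ∀ j, u j ∈ Set.range (f s)} ⊆ ⋃ σ, t j σ := by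
    intro j u hu
    choose x hx using hu
    refine Set.mem_iUnion.2 ⟨fun i n => x i n, ?_⟩
    intro i _
    exact ⟨x i, fun n => rfl, hx i⟩
  have key := Measure.hausdorffMeasure_le_liminf_sum (d : ℝ)
    {u : Fin k → ℝ | ∀ j, u j ∈ Set.range (f s)} r hr t
    (Filter.Eventually.of_forall htd) (Filter.Eventually.of_forall hst)
  refine ne_top_of_le_ne_top (b := ENNReal.ofReal ((2:ℝ)^(d:ℝ))) ENNReal.ofReal_ne_top
    (key.trans ?_)
  refine Filter.liminf_le_of_frequently_le' (Filter.Eventually.frequently ?_)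
  have hd' : (0:ℝ) < d := hd
  filter_upwards [Filter.eventually_ge_atTop ⌈(k:ℝ) / d⌉₊] with j hj
  have hkj : (k:ℝ) ≤ j * d := by
    have := Nat.ceil_le.1 hj
    rwa [div_le_iff₀ hd'] at this
  have hsj : (j:ℝ) * j.factorial ≤ s j.factorial := by exact_mod_cast h1 j
  calc ∑ σ, Metric.ediam (t j σ) ^ (d:ℝ) ≤ ∑ σ : Fin k → Fin j.factorial → Bool, r j ^ (d:ℝ) :=
        Finset.sum_le_sum fun σ _ => ENNReal.rpow_le_rpow (htd j σ) hd'.le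
    _ = ENNReal.ofReal (((2:ℝ)^j.factorial)^k) * r j ^ (d:ℝ) := by
        simp [ENNReal.ofReal_pow]
    _ = ENNReal.ofReal (((2:ℝ)^j.factorial)^k *
          ((1/4 : ℝ)^(s j.factorial) * (4/3)) ^ (d:ℝ)) := by
        rw [ENNReal.ofReal_mul (by positivity), ENNReal.ofReal_rpow_of_nonneg (by positivity) hd'.le]
    _ ≤ ENNReal.ofReal ((2:ℝ)^(d:ℝ)) := by
        apply ENNReal.ofReal_le_ofReal
        generalize j.factorial = N at hsj
        have ha : (1/4 : ℝ)^(s N) * (4/3) ≤ (2:ℝ)^(1 - (s N : ℝ)) := by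
          rw [Real.rpow_sub (by norm_num), Real.rpow_one, Real.rpow_natCast,
            show (2:ℝ) / 2 ^ s N = (1/2)^(s N) * 2 by rw [one_div, inv_pow]; ring]
          gcongr <;> norm_num
        have hb : ((1/4 : ℝ)^(s N) * (4/3)) ^ (d:ℝ) ≤ (2:ℝ)^((1 - (s N : ℝ)) * d) := by
          rw [Real.rpow_mul (by norm_num)]
          exact Real.rpow_le_rpow (by positivity) ha hd'.le
        calc ((2:ℝ)^N)^k * ((1/4 : ℝ)^(s N) * (4/3)) ^ (d:ℝ)
            ≤ ((2:ℝ)^N)^k * (2:ℝ)^((1 - (s N : ℝ)) * d) := by gcongr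
          _ = (2:ℝ)^((N:ℝ) * k + (1 - (s N : ℝ)) * d) := by
              rw [Real.rpow_add (by norm_num), ← pow_mul, ← Real.rpow_natCast]; push_cast; rfl
          _ ≤ (2:ℝ)^(d:ℝ) := by
              apply Real.rpow_le_rpow_of_exponent_le (by norm_num)
              have e1 := mul_le_mul_of_nonneg_right hsj hd'.le
              have e2 := mul_le_mul_of_nonneg_left hkj (Nat.cast_nonneg (α := ℝ) N)
              nlinarith

end PackEx

theorem stmt16 :
    ∃ A : Set ℝ, IsCompact A ∧ 0 < packingDim A ∧ packingDim A < 1 ∧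
      ∀ k : ℕ, 1 ≤ k → dimH {u : Fin k → ℝ | ∀ j, u j ∈ A} = 0 := by
  obtain ⟨s, hs, h1, h2⟩ := PackEx.exists_s
  exact ⟨Set.range (PackEx.f s), isCompact_range (PackEx.f_cont hs), PackEx.pack_pos hs h2,
    PackEx.pack_lt hs, fun k _ => PackEx.dim_zero hs h1 k⟩
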